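/- Let n ≥ 1, l ≥ 2, m = (l−1)n, let H : ℝ^m → ℝ be continuous with H(y) > 0 for y ≠ 0 and H(λy) = λ^{α′}H(y) for all λ > 0 with α′ > 0, let c ∈ ℝ, let F : ℝ^m → ℝ be bounded measurable with F(y) → 0 as |y| → ∞, and set W(y) = (c + F(y))/(1 + H(y)). Let f : ℝⁿ → ℝ be continuous with compact support and let X₁, …, X_l ∈ ℝⁿ be such that for all x₁, …, x_l in the support of f the vector ((x₁−x₂)+(X₁−X₂), …, (x_{l−1}−x_l)+(X_{l−1}−X_l)) is nonzero. Set γ_l = n − α′/l and write I(R) = ∫_{(ℝⁿ)^l} W(x₁−x₂+R(X₁−X₂), …, x_{l−1}−x_l+R(X_{l−1}−X_l)) ∏_{i=1}^{l} f(x_i/R) dx. Then: (i) for every γ′ > γ_l, lim_{R→∞} R^{−lγ′} I(R) = 0; and (ii) for every γ′ < γ_l, if c·∫ H((x₁−x₂)+(X₁−X₂), …)^{−1} ∏ f(x_i) dx ≠ 0, then |R^{−lγ′} I(R)| → ∞ as R → ∞. -/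

import Mathlib

open MeasureTheory Filter

/-- Away from the origin, a function `(c + F) / (1 + H)` with `F` vanishing at infinity and `H`
positively homogeneous of degree `α` decays along rays like `c / H`. -/
theorem tendsto_rpow_mul_div_one_add_homogeneous {E : Type*} [NormedAddCommGroup E]
    [NormedSpace ℝ E] [ProperSpace E] {α : ℝ} (hα : 0 < α) {H F : E → ℝ}
    (hHhom : ∀ lam : ℝ, 0 < lam → ∀ y, H (lam • y) = lam ^ α * H y) (c : ℝ)
    (hF : Tendsto F (cocompact E) (nhds 0)) {y : E} (hy : y ≠ 0) (hHy : 0 < H y) :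
    Tendsto (fun R : ℝ => R ^ α * ((c + F (R • y)) / (1 + H (R • y)))) atTop
      (nhds (c * (H y)⁻¹)) := by
  have hray : Tendsto (fun R : ℝ => R • y) atTop (cocompact E) := by
    rw [← Metric.cobounded_eq_cocompact, ← tendsto_norm_atTop_iff_cobounded]
    simp only [norm_smul]
    exact tendsto_norm_atTop_atTop.atTop_mul_const (norm_pos_iff.2 hy)
  have hlim : Tendsto (fun R : ℝ => (c + F (R • y)) / (R ^ (-α) + H y)) atTop
      (nhds ((c + 0) / (0 + H y))) :=
    ((hF.comp hray).const_add c).div ((tendsto_rpow_neg_atTop hα).add_const _)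
      (by simpa using hHy.ne')
  rw [add_zero, zero_add, div_eq_mul_inv] at hlim
  refine hlim.congr' ?_
  filter_upwards [eventually_gt_atTop 0] with R hR
  have hRα : 0 < R ^ α := Real.rpow_pos_of_pos hR α
  rw [hHhom R hR, Real.rpow_neg hR.le]
  have h₁ : 0 < (R ^ α)⁻¹ + H y := by positivity
  have h₂ : 0 < 1 + R ^ α * H y := by positivity
  field_simp

/-- The smeared function, rescaled with its threshold exponent, converges. -/
theorem tendsto_rpow_mul_integral_rescaled {V E : Type*} [NormedAddCommGroup V] [NormedSpace ℝ V]
    [MeasurableSpace V] [BorelSpace V] {μ : Measure V}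
    [NormedAddCommGroup E] [NormedSpace ℝ E] [ProperSpace E] [MeasurableSpace E] [BorelSpace E]
    {α : ℝ} (hα : 0 < α) {H F : E → ℝ} (hHcont : Continuous H)
    (hHpos : ∀ y, y ≠ 0 → 0 < H y)
    (hHhom : ∀ lam : ℝ, 0 < lam → ∀ y, H (lam • y) = lam ^ α * H y) (c : ℝ)
    (hFmeas : Measurable F) {C : ℝ} (hFbdd : ∀ y, |F y| ≤ C)
    (hF : Tendsto F (cocompact E) (nhds 0)) {D : V → E} (hD : Continuous D)
    {g : V → ℝ} (hg : Continuous g) (hgint : Integrable g μ) {K : Set V} (hK : IsCompact K)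
    (hgK : ∀ x, g x ≠ 0 → x ∈ K) (hDK : ∀ x ∈ K, D x ≠ 0) :
    Tendsto (fun R : ℝ => R ^ α *
        ∫ x, (c + F (R • D x)) / (1 + H (R • D x)) * g x ∂μ) atTop
      (nhds (c * ∫ x, (H (D x))⁻¹ * g x ∂μ)) := by
  obtain ⟨δ, hδ, hKδ⟩ := hK.exists_forall_le' (f := fun x => H (D x)) (a := (0 : ℝ))
    (hHcont.comp hD).continuousOn fun x hx => hHpos _ (hDK x hx)
  simp only [← integral_const_mul]
  refine tendsto_integral_filter_of_dominated_convergence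
    (fun x => (|c| + C) / δ * |g x|) ?_ ?_ (hgint.abs.const_mul _) ?_
  · refine Eventually.of_forall fun R => Measurable.aestronglyMeasurable ?_
    have hRD : Measurable fun x => R • D x := (hD.const_smul R).measurable
    exact measurable_const.mul ((((hFmeas.comp hRD).const_add c).div
      ((hHcont.measurable.comp hRD).const_add 1)).mul hg.measurable)
  · filter_upwards [eventually_gt_atTop 0] with R hR
    refine Eventually.of_forall fun x => ?_
    by_cases hx : g x = 0
    · simp [hx]
    have hxδ : δ ≤ H (D x) := hKδ x (hgK x hx)
    have hRα : 0 < R ^ α := Real.rpow_pos_of_pos hR α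
    rw [hHhom R hR, ← mul_assoc, norm_mul, Real.norm_eq_abs, Real.norm_eq_abs]
    refine mul_le_mul_of_nonneg_right ?_ (abs_nonneg _)
    have hpos : 0 < 1 + R ^ α * H (D x) := by
      have := hδ.trans_le hxδ
      positivity
    have hnum : |c + F (R • D x)| ≤ |c| + C :=
      (abs_add_le _ _).trans (add_le_add le_rfl (hFbdd _))
    rw [abs_mul, abs_div, abs_of_pos hRα, abs_of_pos hpos, ← mul_div_assoc,
      div_le_div_iff₀ hpos hδ]
    calc R ^ α * |c + F (R • D x)| * δ = |c + F (R • D x)| * (R ^ α * δ) := by ring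
      _ ≤ (|c| + C) * (1 + R ^ α * H (D x)) := by
        refine mul_le_mul hnum ?_ (by positivity) ((abs_nonneg _).trans hnum)
        have := mul_le_mul_of_nonneg_left hxδ hRα.le
        linarith
  · refine Eventually.of_forall fun x => ?_
    by_cases hx : g x = 0
    · simp [hx]
    have hDx := hDK x (hgK x hx)
    simpa only [mul_assoc] using
      (tendsto_rpow_mul_div_one_add_homogeneous hα hHhom c hF hDx (hHpos _ hDx)).mul_const (g x)

/-- Conclusion 5.2 (the trichotomy), parts (i) and (ii): with the threshold
exponent `γ_l = n - α'/l` (here `l = k + 1`), scaling the renormalised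
truncated `l`-point function with any exponent `γ' > γ_l` produces `0` in the
scaling limit, while any exponent `γ' < γ_l` produces divergence (given that
the would-be limit at the threshold is nonzero). -/
theorem statement11 (n k : ℕ) (hn : 1 ≤ n) (hk : 1 ≤ k)
    (α' : ℝ) (hα' : 0 < α')
    (H : (Fin k → EuclideanSpace ℝ (Fin n)) → ℝ) (hHcont : Continuous H)
    (hHpos : ∀ y, y ≠ 0 → 0 < H y)
    (hHhom : ∀ lam : ℝ, 0 < lam → ∀ y, H (lam • y) = lam ^ α' * H y)
    (c : ℝ) (F : (Fin k → EuclideanSpace ℝ (Fin n)) → ℝ) (hFmeas : Measurable F)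
    (hFbdd : ∃ C, ∀ y, |F y| ≤ C)
    (hFdecay : Tendsto F (cocompact ((Fin k → EuclideanSpace ℝ (Fin n)))) (nhds 0))
    (W : (Fin k → EuclideanSpace ℝ (Fin n)) → ℝ)
    (hW : ∀ y, W y = (c + F y) / (1 + H y))
    (f : EuclideanSpace ℝ (Fin n) → ℝ) (hf : Continuous f)
    (hfsupp : HasCompactSupport f)
    (X : Fin (k + 1) → EuclideanSpace ℝ (Fin n))
    (hX : ∀ x : Fin (k + 1) → EuclideanSpace ℝ (Fin n), (∀ i, x i ∈ tsupport f) →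
      (fun i : Fin k => (x i.castSucc - x i.succ) + (X i.castSucc - X i.succ)) ≠ 0)
    (γ : ℝ) (hγ : γ = (n : ℝ) - α' / (k + 1)) :
    (∀ γ' : ℝ, γ < γ' →
      Tendsto (fun R : ℝ =>
          R ^ (-(((k + 1 : ℕ) : ℝ) * γ')) *
            ∫ x : Fin (k + 1) → EuclideanSpace ℝ (Fin n),
              W (fun i => (x i.castSucc - x i.succ) + R • (X i.castSucc - X i.succ)) *
                ∏ i, f (R⁻¹ • x i))
        atTop (nhds 0)) ∧
    (∀ γ' : ℝ, γ' < γ →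
      c * (∫ x : Fin (k + 1) → EuclideanSpace ℝ (Fin n),
          (H (fun i => (x i.castSucc - x i.succ) + (X i.castSucc - X i.succ)))⁻¹ *
            ∏ i, f (x i)) ≠ 0 →
      Tendsto (fun R : ℝ =>
          |R ^ (-(((k + 1 : ℕ) : ℝ) * γ')) *
            ∫ x : Fin (k + 1) → EuclideanSpace ℝ (Fin n),
              W (fun i => (x i.castSucc - x i.succ) + R • (X i.castSucc - X i.succ)) *
                ∏ i, f (R⁻¹ • x i)|)
        atTop atTop) := by
  obtain ⟨C, hC⟩ := hFbdd
  set D : (Fin (k + 1) → EuclideanSpace ℝ (Fin n)) → (Fin k → EuclideanSpace ℝ (Fin n)) :=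
    fun x i => (x i.castSucc - x i.succ) + (X i.castSucc - X i.succ) with hDdef
  have hD : Continuous D := by fun_prop
  have hlim := tendsto_rpow_mul_integral_rescaled (μ := volume) hα' hHcont hHpos hHhom c hFmeas hC
    hFdecay hD (g := fun x => ∏ i, f (x i)) (by fun_prop)
    (Integrable.fintype_prod (f := fun _ => f) fun _ => hf.integrable_of_hasCompactSupport hfsupp)
    (isCompact_univ_pi fun _ => hfsupp)
    (fun x hx i _ => subset_tsupport f (Finset.prod_ne_zero_iff.1 hx i (Finset.mem_univ i)))
    (fun x hx => hX x fun i => hx i (Set.mem_univ i))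
  have hscale : ∀ γ' : ℝ, ∀ᶠ R : ℝ in atTop,
      R ^ (((k + 1 : ℕ) : ℝ) * (γ - γ')) * (R ^ α' * ∫ x,
        (c + F (R • D x)) / (1 + H (R • D x)) * ∏ i, f (x i)) =
      R ^ (-(((k + 1 : ℕ) : ℝ) * γ')) *
        ∫ x : Fin (k + 1) → EuclideanSpace ℝ (Fin n),
          W (fun i => (x i.castSucc - x i.succ) + R • (X i.castSucc - X i.succ)) *
            ∏ i, f (R⁻¹ • x i) := by
    intro γ'
    filter_upwards [eventually_gt_atTop 0] with R hR
    have hsub := Measure.integral_comp_smul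
      (volume : Measure (Fin (k + 1) → EuclideanSpace ℝ (Fin n)))
      (fun x => W (fun i => (x i.castSucc - x i.succ) + R • (X i.castSucc - X i.succ)) *
            ∏ i, f (R⁻¹ • x i)) R
    have hint : (fun x : Fin (k + 1) → EuclideanSpace ℝ (Fin n) =>
        W (fun i => ((R • x) i.castSucc - (R • x) i.succ) + R • (X i.castSucc - X i.succ)) *
            ∏ i, f (R⁻¹ • (R • x) i)) =
        fun x => (c + F (R • D x)) / (1 + H (R • D x)) * ∏ i, f (x i) := by
      funext x
      have harg : (fun i : Fin k => ((R • x) i.castSucc - (R • x) i.succ) +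
          R • (X i.castSucc - X i.succ)) = R • D x := by
        funext i
        simp only [hDdef, Pi.smul_apply, smul_add, smul_sub]
      rw [harg, hW]
      simp only [Pi.smul_apply, inv_smul_smul₀ hR.ne']
    have hfin : Module.finrank ℝ (Fin (k + 1) → EuclideanSpace ℝ (Fin n)) = (k + 1) * n := by
      rw [Module.finrank_pi_fintype]
      simp
    rw [hint, hfin, abs_of_pos (by positivity), smul_eq_mul] at hsub
    rw [hsub, ← mul_assoc, ← mul_assoc, ← Real.rpow_natCast, ← Real.rpow_neg hR.le,
      ← Real.rpow_add hR, ← Real.rpow_add hR]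
    congr 2
    have hk0 : (k : ℝ) + 1 ≠ 0 := by positivity
    rw [hγ]
    push_cast
    field_simp
    ring
  have hkpos : (0 : ℝ) < ((k + 1 : ℕ) : ℝ) := by positivity
  refine ⟨fun γ' hγ' => ?_, fun γ' hγ' hne => ?_⟩
  · have hpow : Tendsto (fun R : ℝ => R ^ (((k + 1 : ℕ) : ℝ) * (γ - γ'))) atTop (nhds 0) := by
      have := tendsto_rpow_neg_atTop (mul_pos hkpos (sub_pos.2 hγ'))
      rwa [← mul_neg, neg_sub] at this
    have := hpow.mul hlim
    rw [zero_mul] at this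
    exact this.congr' (hscale γ')
  · have hpow := tendsto_rpow_atTop (mul_pos hkpos (sub_pos.2 hγ'))
    refine ((tendsto_abs_atTop_atTop.comp hpow).atTop_mul_pos (abs_pos.2 hne) hlim.abs).congr' ?_
    filter_upwards [hscale γ'] with R hR
    simp only [Function.comp_apply, ← hR, abs_mul]
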